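/- For all positive integers m, n and every nonnegative integer d, the following identity of polynomials in x_1,…,x_n, y_1,…,y_m holds: the sum over all partitions λ of d of s_λ(x_1,…,x_n)·s_λ(y_1,…,y_m) equals the complete homogeneous symmetric polynomial of degree d in the mn variables {x_i y_j : 1 ≤ i ≤ n, 1 ≤ j ≤ m}, i.e. the sum over all n×m matrices A = (a_{ij}) of nonnegative integers with total sum d of ∏_{i,j} (x_i y_j)^{a_{ij}}. -/

import Mathlib

/-- The weight of a semistandard Young tableau: `ssytWeight T i` is the number of cells of the
tableau whose entry equals `i`. -/
def ssytWeight {μ : YoungDiagram} (T : SemistandardYoungTableau μ) (i : ℕ) : ℕ :=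
  (μ.cells.filter fun c => T c.1 c.2 = i).card

/-- `tabCard μ ν` is the number of semistandard Young tableaux of shape `μ` and weight `ν`,
where `ν : Fin n → ℕ`: the entry `j` (for `j < n`) occurs exactly `ν j` times, and no entry
`≥ n` occurs. -/
noncomputable def tabCard (μ : YoungDiagram) {n : ℕ} (ν : Fin n → ℕ) : ℕ :=
  Set.ncard {T : SemistandardYoungTableau μ |
    ∀ j : ℕ, ssytWeight T j = if h : j < n then ν ⟨j, h⟩ else 0}

/-- The Schur polynomial `s_μ(x_0, …, x_{n-1})`, as the generating function of semistandard
Young tableaux of shape `μ` with entries in `{0, …, n-1}`. -/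
noncomputable def schurPoly (n : ℕ) (μ : YoungDiagram) : MvPolynomial (Fin n) ℤ :=
  ∑ᶠ (T : SemistandardYoungTableau μ) (_ : ∀ c ∈ μ.cells, T c.1 c.2 < n),
    ∏ i : Fin n, (MvPolynomial.X i : MvPolynomial (Fin n) ℤ) ^ ssytWeight T (i : ℕ)

/-- The number of odd rows (odd parts) of a Young diagram. -/
def oddRowsCount (lam : YoungDiagram) : ℕ :=
  lam.rowLens.countP fun r => r % 2 = 1

/-- The number of odd columns of a Young diagram. -/
def oddColsCount (lam : YoungDiagram) : ℕ :=
  oddRowsCount lam.transpose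

/-- A Young diagram is a *threshold* partition if its Frobenius coordinates satisfy
`β i = α i + 1` for each `i` up to the Durfee rank; with 0-indexed diagrams this says that
`colLen i = rowLen i + 1` for each diagonal cell `(i, i)`. -/
def YoungDiagram.IsThreshold (lam : YoungDiagram) : Prop :=
  ∀ i : ℕ, (i, i) ∈ lam → lam.colLen i = lam.rowLen i + 1

namespace YoungDiagram

theorem ext_rowLen {μ ν : YoungDiagram} (h : ∀ i, μ.rowLen i = ν.rowLen i) : μ = ν := by
  refine SetLike.ext fun c => ?_
  rw [← Prod.mk.eta (p := c), mem_iff_lt_rowLen, mem_iff_lt_rowLen, h]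

theorem exists_rowLen_eq_zero (μ : YoungDiagram) : ∃ N, μ.rowLen N = 0 := by
  refine ⟨μ.colLen 0, ?_⟩
  have h : (μ.colLen 0, 0) ∉ μ := by simp [mem_iff_lt_colLen]
  simpa [mem_iff_lt_rowLen] using h

theorem card_eq_sum_rowLen (μ : YoungDiagram) {N : ℕ} (hN : μ.rowLen N = 0) :
    μ.card = ∑ i ∈ Finset.range N, μ.rowLen i := by
  have hmaps : ∀ c ∈ μ.cells, c.1 ∈ Finset.range N := by
    rintro ⟨i, j⟩ hc
    rw [mem_cells, mem_iff_lt_rowLen] at hc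
    rw [Finset.mem_range]
    by_contra! h
    have := μ.rowLen_anti N i h
    omega
  rw [YoungDiagram.card, Finset.card_eq_sum_card_fiberwise hmaps]
  refine Finset.sum_congr rfl fun i _ => ?_
  rw [rowLen_eq_card]
  rfl

theorem isLowerSet_filter_lt {f : ℕ → ℕ} (hf : Antitone f) (N : ℕ) :
    IsLowerSet (((Finset.range N ×ˢ Finset.range (f 0)).filter fun c => c.2 < f c.1 :
      Finset (ℕ × ℕ)) : Set (ℕ × ℕ)) := by
  rintro ⟨i, j⟩ ⟨i', j'⟩ ⟨hi, hj⟩ hc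
  have h₁ := hf hi
  have h₂ := hf (Nat.zero_le i')
  simp only [Finset.coe_filter, Finset.mem_product, Finset.mem_range,
    Set.mem_ofPred_eq] at hc hi hj h₁ ⊢
  omega

open Classical in
/-- The Young diagram with row lengths `f`, or `⊥` if `f` is not antitone or never vanishes. -/
noncomputable def ofRowFun (f : ℕ → ℕ) : YoungDiagram :=
  if h : Antitone f ∧ ∃ N, f N = 0 then
    ⟨_, isLowerSet_filter_lt h.1 h.2.choose⟩
  else ⊥

theorem rowLen_ofRowFun {f : ℕ → ℕ} (hf : Antitone f) (hz : ∃ N, f N = 0) (i : ℕ) :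
    (ofRowFun f).rowLen i = f i := by
  refine eq_of_forall_lt_iff fun j => ?_
  rw [← mem_iff_lt_rowLen, ofRowFun, dif_pos ⟨hf, hz⟩]
  simp only [mem_mk, Finset.mem_filter, Finset.mem_product, Finset.mem_range]
  refine ⟨fun h => h.2, fun h => ⟨⟨?_, ?_⟩, h⟩⟩
  · by_contra! hi
    have := hf hi
    have := hz.choose_spec
    omega
  · have := hf (Nat.zero_le i)
    omega

/-- `ν.IsStrip μ` says that `ν ≤ μ` and the skew shape `μ / ν` is a horizontal strip. -/
def IsStrip (ν μ : YoungDiagram) : Prop :=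
  ∀ i, μ.rowLen (i + 1) ≤ ν.rowLen i ∧ ν.rowLen i ≤ μ.rowLen i

theorem IsStrip.le {ν μ : YoungDiagram} (h : ν.IsStrip μ) : ν ≤ μ := by
  rintro ⟨i, j⟩ hc
  have := (h i).2
  simp only [mem_iff_lt_rowLen] at hc ⊢
  omega

theorem card_mono {ν μ : YoungDiagram} (h : ν ≤ μ) : ν.card ≤ μ.card :=
  Finset.card_le_card (cells_subset_iff.2 h)

theorem finite_Iic (μ : YoungDiagram) : {ν : YoungDiagram | ν ≤ μ}.Finite := by
  refine Set.Finite.of_finite_image (f := YoungDiagram.cells)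
    (μ.cells.powerset.finite_toSet.subset ?_) ?_
  · rintro _ ⟨ν, hν, rfl⟩
    simpa using hν
  · intro ν _ ν' _ h
    exact YoungDiagram.ext h

theorem finite_card_eq (d : ℕ) : {μ : YoungDiagram | μ.card = d}.Finite := by
  refine Set.Finite.of_finite_image (f := YoungDiagram.cells)
    ((Finset.range d ×ˢ Finset.range d).powerset.finite_toSet.subset ?_) ?_
  · rintro _ ⟨μ, rfl, rfl⟩
    simp only [Finset.coe_powerset, Set.mem_preimage, Set.mem_powerset_iff, Finset.coe_subset]
    rintro ⟨i, j⟩ hc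
    have h₁ : (Finset.range (i + 1) ×ˢ {j}).card ≤ μ.card := by
      refine Finset.card_le_card ?_
      rintro ⟨i', j'⟩ h
      simp only [Finset.mem_product, Finset.mem_range, Finset.mem_singleton] at h
      exact μ.up_left_mem (by omega) (by omega) hc
    have h₂ : (({i} : Finset ℕ) ×ˢ Finset.range (j + 1)).card ≤ μ.card := by
      refine Finset.card_le_card ?_
      rintro ⟨i', j'⟩ h
      simp only [Finset.mem_product, Finset.mem_range, Finset.mem_singleton] at h
      exact μ.up_left_mem (by omega) (by omega) hc
    simp only [Finset.card_product, Finset.card_range, Finset.card_singleton] at h₁ h₂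
    simp only [Finset.mem_product, Finset.mem_range]
    omega
  · intro ν _ ν' _ h
    exact YoungDiagram.ext h

/-- The Young diagrams with `d` cells. -/
noncomputable def ofCard (d : ℕ) : Finset YoungDiagram := (finite_card_eq d).toFinset

@[simp]
theorem mem_ofCard {d : ℕ} {μ : YoungDiagram} : μ ∈ ofCard d ↔ μ.card = d := by simp [ofCard]

/-- The diagrams obtained from `μ` by removing a horizontal strip. -/
noncomputable def stripsBelow (μ : YoungDiagram) : Finset YoungDiagram :=
  ((finite_Iic μ).subset fun _ (h : IsStrip _ μ) => h.le).toFinset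

@[simp]
theorem mem_stripsBelow {ν μ : YoungDiagram} : ν ∈ μ.stripsBelow ↔ ν.IsStrip μ :=
  Set.Finite.mem_toFinset _

/-- The diagrams obtained from `ν` by adding a horizontal strip with `b` cells. -/
noncomputable def stripsAbove (ν : YoungDiagram) (b : ℕ) : Finset YoungDiagram :=
  ((finite_card_eq (ν.card + b)).subset
    fun μ (h : ν.IsStrip μ ∧ μ.card = ν.card + b) => h.2).toFinset

@[simp]
theorem mem_stripsAbove {ν μ : YoungDiagram} {b : ℕ} :
    μ ∈ ν.stripsAbove b ↔ ν.IsStrip μ ∧ μ.card = ν.card + b :=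
  Set.Finite.mem_toFinset _

@[simp]
theorem card_eq_zero_iff {μ : YoungDiagram} : μ.card = 0 ↔ μ = ⊥ := by
  rw [YoungDiagram.card, Finset.card_eq_zero]
  exact ⟨fun h => YoungDiagram.ext h, fun h => by rw [h]; rfl⟩

/-- The inner diagram in the local growth rule. -/
noncomputable def growthInner (lam ν μ : YoungDiagram) : YoungDiagram :=
  ofRowFun fun i => max (lam.rowLen (i + 1)) (ν.rowLen (i + 1)) +
    min (lam.rowLen i) (ν.rowLen i) - μ.rowLen (i + 1)

/-- The outer diagram in the local growth rule, with `k` extra cells in the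
first row. -/
noncomputable def growthOuter (lam ν ρ : YoungDiagram) (k : ℕ) : YoungDiagram :=
  ofRowFun fun i => i.casesOn (max (lam.rowLen 0) (ν.rowLen 0) + k) fun i =>
    max (lam.rowLen (i + 1)) (ν.rowLen (i + 1)) + min (lam.rowLen i) (ν.rowLen i) - ρ.rowLen i

section GrowthRule

variable {lam ν μ ρ : YoungDiagram}

theorem rowLen_growthInner (h₁ : lam.IsStrip μ) (h₂ : ν.IsStrip μ) (i : ℕ) :
    (growthInner lam ν μ).rowLen i = max (lam.rowLen (i + 1)) (ν.rowLen (i + 1)) +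
      min (lam.rowLen i) (ν.rowLen i) - μ.rowLen (i + 1) := by
  refine rowLen_ofRowFun (antitone_nat_of_succ_le fun i => ?_) ?_ i
  · have := h₁ i; have := h₂ i; have := h₁ (i + 1); have := h₂ (i + 1)
    have := h₁ (i + 1 + 1); have := h₂ (i + 1 + 1)
    omega
  · obtain ⟨N, hN⟩ := lam.exists_rowLen_eq_zero
    refine ⟨N, ?_⟩
    have := h₁ (N + 1); have := h₂ (N + 1); have := lam.rowLen_anti N (N + 1) (by omega)
    omega

theorem rowLen_growthOuter_zero_succ (h₁ : ρ.IsStrip lam) (h₂ : ρ.IsStrip ν) (k : ℕ) :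
    (growthOuter lam ν ρ k).rowLen 0 = max (lam.rowLen 0) (ν.rowLen 0) + k ∧
    ∀ i, (growthOuter lam ν ρ k).rowLen (i + 1) =
      max (lam.rowLen (i + 1)) (ν.rowLen (i + 1)) + min (lam.rowLen i) (ν.rowLen i) -
        ρ.rowLen i := by
  have key := rowLen_ofRowFun (f := fun i => i.casesOn (max (lam.rowLen 0) (ν.rowLen 0) + k)
    fun i => max (lam.rowLen (i + 1)) (ν.rowLen (i + 1)) + min (lam.rowLen i) (ν.rowLen i) -
      ρ.rowLen i) (antitone_nat_of_succ_le fun i => ?_) ?_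
  · exact ⟨key 0, fun i => key (i + 1)⟩
  · cases i with
    | zero =>
      have := h₁ 0; have := h₂ 0
      change max (lam.rowLen (0 + 1)) (ν.rowLen (0 + 1)) + min (lam.rowLen 0) (ν.rowLen 0) - ρ.rowLen 0 ≤
        max (lam.rowLen 0) (ν.rowLen 0) + k
      omega
    | succ i =>
      have := h₁ i; have := h₂ i; have := h₁ (i + 1); have := h₂ (i + 1)
      dsimp only; omega
  · obtain ⟨N, hN⟩ := lam.exists_rowLen_eq_zero
    obtain ⟨M, hM⟩ := ν.exists_rowLen_eq_zero
    refine ⟨N + M + 1, ?_⟩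
    have := lam.rowLen_anti N (N + M) (by omega)
    have := lam.rowLen_anti N (N + M + 1) (by omega)
    have := ν.rowLen_anti M (N + M + 1) (by omega)
    dsimp only; omega

theorem growthInner_isStrip (h₁ : lam.IsStrip μ) (h₂ : ν.IsStrip μ) :
    (growthInner lam ν μ).IsStrip lam ∧ (growthInner lam ν μ).IsStrip ν := by
  refine ⟨fun i => ?_, fun i => ?_⟩ <;>
  · rw [rowLen_growthInner h₁ h₂]
    have := h₁ i; have := h₂ i; have := h₁ (i + 1); have := h₂ (i + 1)
    omega

theorem growthOuter_isStrip (h₁ : ρ.IsStrip lam) (h₂ : ρ.IsStrip ν) (k : ℕ) :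
    lam.IsStrip (growthOuter lam ν ρ k) ∧ ν.IsStrip (growthOuter lam ν ρ k) := by
  obtain ⟨h₀, hs⟩ := rowLen_growthOuter_zero_succ h₁ h₂ k
  refine ⟨fun i => ?_, fun i => ?_⟩ <;>
  · cases i with
    | zero => have := h₁ 0; have := h₂ 0; rw [h₀, hs]; omega
    | succ i =>
      have := h₁ i; have := h₂ i; have := h₁ (i + 1); have := h₂ (i + 1)
      rw [hs, hs]; omega

theorem growthOuter_growthInner (h₁ : lam.IsStrip μ) (h₂ : ν.IsStrip μ) :
    growthOuter lam ν (growthInner lam ν μ)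
      (μ.rowLen 0 - max (lam.rowLen 0) (ν.rowLen 0)) = μ := by
  obtain ⟨h₃, h₄⟩ := growthInner_isStrip h₁ h₂
  obtain ⟨h₀, hs⟩ := rowLen_growthOuter_zero_succ h₃ h₄
    (μ.rowLen 0 - max (lam.rowLen 0) (ν.rowLen 0))
  refine ext_rowLen fun i => ?_
  cases i with
  | zero => have := h₁ 0; have := h₂ 0; rw [h₀]; omega
  | succ i =>
    have := h₁ i; have := h₂ i; have := h₁ (i + 1); have := h₂ (i + 1)
    rw [hs, rowLen_growthInner h₁ h₂]; omega

theorem growthInner_growthOuter (h₁ : ρ.IsStrip lam) (h₂ : ρ.IsStrip ν) (k : ℕ) :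
    growthInner lam ν (growthOuter lam ν ρ k) = ρ := by
  obtain ⟨h₃, h₄⟩ := growthOuter_isStrip h₁ h₂ k
  refine ext_rowLen fun i => ?_
  have := h₁ i; have := h₂ i
  rw [rowLen_growthInner h₃ h₄, (rowLen_growthOuter_zero_succ h₁ h₂ k).2]
  omega

theorem card_growthOuter (h₁ : ρ.IsStrip lam) (h₂ : ρ.IsStrip ν) (k : ℕ) :
    (growthOuter lam ν ρ k).card + ρ.card = lam.card + ν.card + k := by
  obtain ⟨h₀, hs⟩ := rowLen_growthOuter_zero_succ h₁ h₂ k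
  obtain ⟨N, hN⟩ := lam.exists_rowLen_eq_zero
  obtain ⟨M, hM⟩ := ν.exists_rowLen_eq_zero
  have e₁ := lam.rowLen_anti N (N + M) (by omega)
  have e₂ := lam.rowLen_anti N (N + M + 1) (by omega)
  have e₃ := ν.rowLen_anti M (N + M) (by omega)
  have e₄ := ν.rowLen_anti M (N + M + 1) (by omega)
  have e₅ := (h₁ (N + M)).2
  have e₆ := hs (N + M)
  rw [card_eq_sum_rowLen (growthOuter lam ν ρ k) (N := N + M + 1) (by omega),
    card_eq_sum_rowLen ρ (N := N + M) (by omega),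
    card_eq_sum_rowLen lam (N := N + M) (by omega),
    card_eq_sum_rowLen ν (N := N + M) (by omega), Finset.sum_range_succ', h₀]
  have hmax := Finset.sum_range_succ' (fun i => max (lam.rowLen i) (ν.rowLen i)) (N + M)
  rw [Finset.sum_range_succ] at hmax
  have hstep : ∑ i ∈ Finset.range (N + M), (growthOuter lam ν ρ k).rowLen (i + 1) +
      ∑ i ∈ Finset.range (N + M), ρ.rowLen i =
      ∑ i ∈ Finset.range (N + M), max (lam.rowLen (i + 1)) (ν.rowLen (i + 1)) +
      ∑ i ∈ Finset.range (N + M), min (lam.rowLen i) (ν.rowLen i) := by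
    rw [← Finset.sum_add_distrib, ← Finset.sum_add_distrib]
    refine Finset.sum_congr rfl fun i _ => ?_
    have := h₁ i; have := h₂ i
    rw [hs]; omega
  have hmm : ∑ i ∈ Finset.range (N + M), max (lam.rowLen i) (ν.rowLen i) +
      ∑ i ∈ Finset.range (N + M), min (lam.rowLen i) (ν.rowLen i) =
      ∑ i ∈ Finset.range (N + M), lam.rowLen i + ∑ i ∈ Finset.range (N + M), ν.rowLen i := by
    rw [← Finset.sum_add_distrib, ← Finset.sum_add_distrib]
    exact Finset.sum_congr rfl fun i _ => max_add_min _ _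
  omega

theorem card_growthInner (h₁ : lam.IsStrip μ) (h₂ : ν.IsStrip μ) :
    μ.card + (growthInner lam ν μ).card =
      lam.card + ν.card + (μ.rowLen 0 - max (lam.rowLen 0) (ν.rowLen 0)) := by
  obtain ⟨h₃, h₄⟩ := growthInner_isStrip h₁ h₂
  have := card_growthOuter h₃ h₄ (μ.rowLen 0 - max (lam.rowLen 0) (ν.rowLen 0))
  rwa [growthOuter_growthInner h₁ h₂] at this

/-- Commutation of adding a horizontal strip with removing a horizontal strip. -/
theorem sum_stripsAbove_stripsBelow {R : Type*} [CommSemiring R] (lam : YoungDiagram) (b : ℕ)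
    (f : YoungDiagram → R) (z : R) :
    ∑ μ ∈ lam.stripsAbove b, ∑ ν ∈ μ.stripsBelow, f ν * z ^ (μ.card - ν.card) =
      ∑ p ∈ Finset.HasAntidiagonal.antidiagonal b, ∑ ρ ∈ lam.stripsBelow, ∑ ν ∈ ρ.stripsAbove p.1,
        f ν * z ^ (lam.card - ρ.card) * z ^ p.2 := by
  simp only [Finset.sum_sigma']
  refine Finset.sum_bij'
    (fun a _ =>
      let k := a.1.rowLen 0 - max (lam.rowLen 0) (a.2.rowLen 0)
      ⟨(b - k, k), growthInner lam a.2 a.1, a.2⟩)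
    (fun a _ => ⟨growthOuter lam a.2.2 a.2.1 a.1.2, a.2.2⟩) ?_ ?_ ?_ ?_ ?_
  · rintro ⟨μ, ν⟩ ha
    simp only [Finset.mem_sigma, mem_stripsAbove, mem_stripsBelow,
      Finset.HasAntidiagonal.mem_antidiagonal] at ha ⊢
    obtain ⟨⟨h₁, hb⟩, h₂⟩ := ha
    obtain ⟨h₃, h₄⟩ := growthInner_isStrip h₁ h₂
    have := card_growthInner h₁ h₂
    have := card_mono h₄.le
    exact ⟨by omega, h₃, h₄, by omega⟩
  · rintro ⟨⟨l, k⟩, ρ, ν⟩ ha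
    simp only [Finset.mem_sigma, mem_stripsAbove, mem_stripsBelow,
      Finset.HasAntidiagonal.mem_antidiagonal] at ha ⊢
    obtain ⟨hb, h₁, h₂, hν⟩ := ha
    obtain ⟨h₃, h₄⟩ := growthOuter_isStrip h₁ h₂ k
    have := card_growthOuter h₁ h₂ k
    exact ⟨⟨h₃, by omega⟩, h₄⟩
  · rintro ⟨μ, ν⟩ ha
    simp only [Finset.mem_sigma, mem_stripsAbove, mem_stripsBelow] at ha
    simp only [growthOuter_growthInner ha.1.1 ha.2]
  · rintro ⟨⟨l, k⟩, ρ, ν⟩ ha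
    simp only [Finset.mem_sigma, mem_stripsAbove, mem_stripsBelow,
      Finset.HasAntidiagonal.mem_antidiagonal] at ha
    obtain ⟨hb, h₁, h₂, hν⟩ := ha
    have hk : (growthOuter lam ν ρ k).rowLen 0 - max (lam.rowLen 0) (ν.rowLen 0) = k := by
      rw [(rowLen_growthOuter_zero_succ h₁ h₂ k).1]; omega
    have hl : b - k = l := by omega
    simp only [growthInner_growthOuter h₁ h₂, hk, hl]
  · rintro ⟨μ, ν⟩ ha
    simp only [Finset.mem_sigma, mem_stripsAbove, mem_stripsBelow] at ha
    obtain ⟨⟨h₁, hb⟩, h₂⟩ := ha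
    have := card_growthInner h₁ h₂
    have := card_mono (growthInner_isStrip h₁ h₂).1.le
    have := card_mono h₂.le
    rw [mul_assoc, ← pow_add]
    congr 2
    dsimp only
    omega

end GrowthRule

end YoungDiagram

namespace SemistandardYoungTableau

open YoungDiagram

theorem finite_entries_lt (n : ℕ) (μ : YoungDiagram) :
    {T : SemistandardYoungTableau μ | ∀ c ∈ μ.cells, T c.1 c.2 < n}.Finite := by
  have := Finset.finite_toSet (Fintype.piFinset fun _ : μ.cells => Finset.range n)
  refine Set.Finite.of_finite_image (f := fun T (c : μ.cells) => T c.1.1 c.1.2)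
    (this.subset ?_) ?_
  · rintro _ ⟨T, hT, rfl⟩
    simp only [Finset.mem_coe, Fintype.mem_piFinset, Finset.mem_range]
    exact fun c => hT c.1 c.2
  · intro T _ T' _ h
    refine SemistandardYoungTableau.ext fun i j => ?_
    by_cases hc : (i, j) ∈ μ
    · exact congrFun h ⟨(i, j), hc⟩
    · rw [T.zeros hc, T'.zeros hc]

/-- The semistandard tableaux of shape `μ` with entries smaller than `n`. -/
noncomputable def entriesLT (n : ℕ) (μ : YoungDiagram) : Finset (SemistandardYoungTableau μ) :=
  (finite_entries_lt n μ).toFinset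

@[simp]
theorem mem_entriesLT {n : ℕ} {μ : YoungDiagram} {T : SemistandardYoungTableau μ} :
    T ∈ entriesLT n μ ↔ ∀ c ∈ μ, T c.1 c.2 < n := by
  simp [entriesLT]

/-- The shape formed by the cells whose entry is smaller than `n`. -/
def shapeLT {μ : YoungDiagram} (T : SemistandardYoungTableau μ) (n : ℕ) : YoungDiagram where
  cells := μ.cells.filter fun c => T c.1 c.2 < n
  isLowerSet := by
    intro c c' hle hc
    have hle' : c'.1 ≤ c.1 ∧ c'.2 ≤ c.2 := hle
    rw [Finset.mem_coe, Finset.mem_filter, mem_cells] at hc ⊢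
    have hmem : (c'.1, c.2) ∈ μ := μ.up_left_mem hle'.1 le_rfl hc.1
    have h₁ := T.col_weak hle'.1 hc.1
    have h₂ := T.row_weak_of_le hle'.2 hmem
    exact ⟨μ.up_left_mem hle'.1 hle'.2 hc.1, by omega⟩

theorem mem_shapeLT {μ : YoungDiagram} {T : SemistandardYoungTableau μ} {n : ℕ} {c : ℕ × ℕ} :
    c ∈ T.shapeLT n ↔ c ∈ μ ∧ T c.1 c.2 < n :=
  Finset.mem_filter

theorem shapeLT_isStrip {n : ℕ} {μ : YoungDiagram} {T : SemistandardYoungTableau μ}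
    (hT : T ∈ entriesLT (n + 1) μ) : (T.shapeLT n).IsStrip μ := by
  rw [mem_entriesLT] at hT
  refine fun i => ⟨le_of_forall_lt fun j hj => ?_, le_of_forall_lt fun j hj => ?_⟩
  · rw [← mem_iff_lt_rowLen] at hj ⊢
    have h₁ := T.col_strict (Nat.lt_add_one i) hj
    have h₂ := hT _ hj
    exact mem_shapeLT.2 ⟨μ.up_left_mem (Nat.le_succ i) le_rfl hj, by dsimp only at h₂ ⊢; omega⟩
  · rw [← mem_iff_lt_rowLen] at hj ⊢
    exact (mem_shapeLT.1 hj).1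

/-- Restriction of a tableau to a smaller shape. -/
def restrict {μ ν : YoungDiagram} (h : ν ≤ μ) (T : SemistandardYoungTableau μ) :
    SemistandardYoungTableau ν where
  entry i j := if (i, j) ∈ ν then T i j else 0
  row_weak' hj hc := by
    rw [if_pos hc, if_pos (ν.up_left_mem le_rfl hj.le hc)]
    exact T.row_weak hj (h hc)
  col_strict' hi hc := by
    rw [if_pos hc, if_pos (ν.up_left_mem hi.le le_rfl hc)]
    exact T.col_strict hi (h hc)
  zeros' hc := if_neg hc

theorem restrict_apply {μ ν : YoungDiagram} (h : ν ≤ μ) (T : SemistandardYoungTableau μ)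
    (i j : ℕ) : T.restrict h i j = if (i, j) ∈ ν then T i j else 0 := rfl

/-- Extension of a tableau with entries smaller than `n` by filling a horizontal strip
with `n`. -/
def extend {μ ν : YoungDiagram} (h : ν.IsStrip μ) (n : ℕ) (T : SemistandardYoungTableau ν)
    (hT : ∀ c ∈ ν, T c.1 c.2 < n) : SemistandardYoungTableau μ where
  entry i j := if (i, j) ∈ ν then T i j else if (i, j) ∈ μ then n else 0
  row_weak' {i j₁ j₂} hj hc := by
    by_cases h₂ : (i, j₂) ∈ ν
    · rw [if_pos h₂, if_pos (ν.up_left_mem le_rfl hj.le h₂)]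
      exact T.row_weak hj h₂
    · rw [if_neg h₂, if_pos hc]
      split_ifs with h₁
      · exact (hT _ h₁).le
      · exact le_rfl
      · exact Nat.zero_le _
  col_strict' {i₁ i₂ j} hi hc := by
    have h₁ : (i₁, j) ∈ ν := by
      rw [mem_iff_lt_rowLen] at hc ⊢
      have := (h i₁).1
      have := μ.rowLen_anti (i₁ + 1) i₂ hi
      omega
    rw [if_pos h₁]
    by_cases h₂ : (i₂, j) ∈ ν
    · rw [if_pos h₂]
      exact T.col_strict hi h₂
    · rw [if_neg h₂, if_pos hc]
      exact hT _ h₁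
  zeros' hc := by rw [if_neg fun h' => hc (h.le h'), if_neg hc]

theorem extend_apply {μ ν : YoungDiagram} (h : ν.IsStrip μ) (n : ℕ)
    (T : SemistandardYoungTableau ν) (hT : ∀ c ∈ ν, T c.1 c.2 < n) (i j : ℕ) :
    T.extend h n hT i j = if (i, j) ∈ ν then T i j else if (i, j) ∈ μ then n else 0 := rfl

end SemistandardYoungTableau

section SchurEval

open SemistandardYoungTableau YoungDiagram

variable {R : Type*} [CommSemiring R]

/-- The value of the Schur polynomial of shape `μ` in `n` variables at `x 0, …, x (n - 1)`. -/
noncomputable def schurEval (x : ℕ → R) (n : ℕ) (μ : YoungDiagram) : R :=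
  ∑ T ∈ entriesLT n μ, ∏ c ∈ μ.cells, x (T c.1 c.2)

theorem schurEval_bot (x : ℕ → R) (n : ℕ) : schurEval x n ⊥ = 1 := by
  have : entriesLT n (⊥ : YoungDiagram) = {default} := by
    refine Finset.eq_singleton_iff_unique_mem.2 ⟨?_, fun T _ => ?_⟩
    · simp
    · exact SemistandardYoungTableau.ext fun i j => by
        rw [T.zeros (notMem_bot _), (default : SemistandardYoungTableau ⊥).zeros (notMem_bot _)]
  rw [schurEval, this]
  simp

theorem schurEval_zero [DecidableEq YoungDiagram] (x : ℕ → R) (μ : YoungDiagram) :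
    schurEval x 0 μ = if μ = ⊥ then 1 else 0 := by
  split_ifs with h
  · rw [h, schurEval_bot]
  · rw [schurEval]
    refine Finset.sum_eq_zero fun T hT => absurd ?_ h
    refine SetLike.ext fun c => ⟨fun hc => ?_, fun hc => absurd hc (notMem_bot _)⟩
    exact absurd (mem_entriesLT.1 hT c hc) (Nat.not_lt_zero _)

/-- Branching rule for Schur polynomials. -/
theorem schurEval_succ (x : ℕ → R) (n : ℕ) (μ : YoungDiagram) :
    schurEval x (n + 1) μ =
      ∑ ν ∈ μ.stripsBelow, schurEval x n ν * x n ^ (μ.card - ν.card) := by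
  classical
  have hmaps : ∀ T ∈ entriesLT (n + 1) μ, T.shapeLT n ∈ μ.stripsBelow := fun T hT =>
    mem_stripsBelow.2 (shapeLT_isStrip hT)
  rw [schurEval, ← Finset.sum_fiberwise_of_maps_to hmaps]
  refine Finset.sum_congr rfl fun ν hν => ?_
  rw [mem_stripsBelow] at hν
  have hlt : ∀ {T : SemistandardYoungTableau ν}, T ∈ entriesLT n ν → ∀ c ∈ ν, T c.1 c.2 < n :=
    fun h => mem_entriesLT.1 h
  rw [schurEval, Finset.sum_mul]
  refine Finset.sum_bij' (fun T _ => T.restrict hν.le)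
    (fun T hT => T.extend hν n (hlt hT)) ?_ ?_ ?_ ?_ ?_
  · intro T hT
    obtain ⟨hT', rfl⟩ := Finset.mem_filter.1 hT
    rw [mem_entriesLT]
    intro c hc
    rw [restrict_apply, if_pos hc]
    exact (mem_shapeLT.1 hc).2
  · intro T hT
    rw [Finset.mem_filter, mem_entriesLT]
    refine ⟨fun c hc => ?_, SetLike.ext fun c => ?_⟩
    · rw [extend_apply]
      split_ifs with h
      · exact (hlt hT c h).trans (Nat.lt_succ_self n)
      · exact Nat.lt_succ_self n
    · rw [mem_shapeLT, extend_apply]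
      refine ⟨fun ⟨h₁, h₂⟩ => ?_, fun h => ⟨hν.le h, ?_⟩⟩
      · by_contra h
        rw [if_neg h, if_pos h₁] at h₂
        exact lt_irrefl _ h₂
      · rw [if_pos h]
        exact hlt hT c h
  · intro T hT
    obtain ⟨hT', rfl⟩ := Finset.mem_filter.1 hT
    refine SemistandardYoungTableau.ext fun i j => ?_
    rw [extend_apply, restrict_apply]
    split_ifs with h₁ h₂
    · rfl
    · have h₃ := mem_entriesLT.1 hT' _ h₂
      rw [mem_shapeLT, not_and] at h₁
      have h₄ := h₁ h₂
      dsimp only at h₃ h₄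
      omega
    · exact (T.zeros h₂).symm
  · intro T hT
    refine SemistandardYoungTableau.ext fun i j => ?_
    rw [restrict_apply, extend_apply]
    split_ifs with h
    · rfl
    · exact (T.zeros h).symm
  · intro T hT
    obtain ⟨hT', rfl⟩ := Finset.mem_filter.1 hT
    have hsub := cells_subset_iff.2 hν.le
    rw [← Finset.prod_sdiff hsub, mul_comm, YoungDiagram.card, YoungDiagram.card,
      ← Finset.card_sdiff_of_subset hsub]
    congr 1
    · refine Finset.prod_congr rfl fun c hc => ?_
      rw [restrict_apply, if_pos ((mem_cells c).1 hc)]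
    · refine Finset.prod_eq_pow_card fun c hc => ?_
      rw [Finset.mem_sdiff, mem_cells, mem_cells, mem_shapeLT, not_and] at hc
      have h₁ := mem_entriesLT.1 hT' c hc.1
      have h₂ := hc.2 hc.1
      rw [show T c.1 c.2 = n by omega]

end SchurEval

section Cauchy

open YoungDiagram PowerSeries

variable {R : Type*} [CommRing R]

/-- Pieri rule for multiplication by a complete homogeneous symmetric polynomial. -/
theorem sum_stripsAbove_schurEval (x : ℕ → R) (n : ℕ) (lam : YoungDiagram) (b : ℕ) :
    ∑ μ ∈ lam.stripsAbove b, schurEval x n μ =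
      coeff b (∏ i ∈ Finset.range n, mk fun k => x i ^ k) * schurEval x n lam := by
  classical
  induction n generalizing lam b with
  | zero =>
    simp only [schurEval_zero, Finset.range_zero, Finset.prod_empty, coeff_one,
      Finset.sum_ite_eq', mem_stripsAbove]
    have h₀ : (⊥ : YoungDiagram).card = 0 := card_eq_zero_iff.2 rfl
    by_cases hl : lam = ⊥
    · subst hl
      have : (⊥ : YoungDiagram).IsStrip ⊥ := fun i => ⟨rowLen_anti _ _ _ (Nat.le_succ i), le_rfl⟩
      simp [h₀, this, eq_comm]
    · rw [if_neg hl, mul_zero, if_neg]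
      rintro ⟨-, h⟩
      exact hl (card_eq_zero_iff.1 (by omega))
  | succ n ih =>
    simp only [schurEval_succ]
    rw [sum_stripsAbove_stripsBelow, Finset.prod_range_succ, coeff_mul, Finset.sum_mul]
    refine Finset.sum_congr rfl fun p _ => ?_
    rw [Finset.mul_sum]
    refine Finset.sum_congr rfl fun ρ _ => ?_
    rw [← Finset.sum_mul, ← Finset.sum_mul, ih, coeff_mk]
    ring

/-- Reordering of a sum over horizontal strips whose outer diagram has `d` cells. -/
theorem sum_ofCard_stripsBelow (d : ℕ) (f : YoungDiagram → YoungDiagram → R) (z : R) :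
    ∑ μ ∈ ofCard d, ∑ ν ∈ μ.stripsBelow, f μ ν * z ^ (μ.card - ν.card) =
      ∑ p ∈ Finset.HasAntidiagonal.antidiagonal d, ∑ ν ∈ ofCard p.1, ∑ μ ∈ ν.stripsAbove p.2,
        f μ ν * z ^ p.2 := by
  simp only [Finset.sum_sigma']
  refine Finset.sum_bij'
    (fun a _ => ⟨(a.2.card, d - a.2.card), a.2, a.1⟩)
    (fun a _ => ⟨a.2.2, a.2.1⟩) ?_ ?_ ?_ ?_ ?_
  · rintro ⟨μ, ν⟩ ha
    simp only [Finset.mem_sigma, mem_stripsAbove, mem_stripsBelow, mem_ofCard,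
      Finset.HasAntidiagonal.mem_antidiagonal] at ha ⊢
    have := card_mono ha.2.le
    exact ⟨by omega, trivial, ha.2, by omega⟩
  · rintro ⟨⟨k, l⟩, ν, μ⟩ ha
    simp only [Finset.mem_sigma, mem_stripsAbove, mem_stripsBelow, mem_ofCard,
      Finset.HasAntidiagonal.mem_antidiagonal] at ha ⊢
    exact ⟨by omega, ha.2.2.1⟩
  · rintro ⟨μ, ν⟩ ha
    rfl
  · rintro ⟨⟨k, l⟩, ν, μ⟩ ha
    simp only [Finset.mem_sigma, mem_stripsAbove, mem_ofCard,
      Finset.HasAntidiagonal.mem_antidiagonal] at ha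
    obtain ⟨hd, rfl, -⟩ := ha
    have : d - ν.card = l := by omega
    simp only [this]
  · rintro ⟨μ, ν⟩ ha
    simp only [Finset.mem_sigma, mem_ofCard] at ha
    rw [ha.1]

/-- Cauchy identity for Schur polynomials, in degree `d`. -/
theorem sum_schurEval_mul_schurEval (x y : ℕ → R) (n m d : ℕ) :
    ∑ lam ∈ ofCard d, schurEval x n lam * schurEval y m lam =
      coeff d (∏ j ∈ Finset.range m, ∏ i ∈ Finset.range n, mk fun k => (x i * y j) ^ k) := by
  classical
  induction m generalizing d with
  | zero =>
    have h₀ : (⊥ : YoungDiagram).card = 0 := card_eq_zero_iff.2 rfl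
    simp only [schurEval_zero, Finset.range_zero, Finset.prod_empty, coeff_one, mul_ite, mul_one,
      mul_zero, Finset.sum_ite_eq', mem_ofCard, schurEval_bot, h₀, eq_comm]
  | succ m ih =>
    have hresc : ∏ i ∈ Finset.range n, mk (fun k => (x i * y m) ^ k) =
        rescale (y m) (∏ i ∈ Finset.range n, mk fun k => x i ^ k) := by
      rw [map_prod]
      refine Finset.prod_congr rfl fun i _ => PowerSeries.ext fun k => ?_
      rw [coeff_rescale, coeff_mk, coeff_mk, mul_pow, mul_comm]
    simp only [schurEval_succ, Finset.mul_sum, ← mul_assoc]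
    rw [sum_ofCard_stripsBelow d (fun μ ν => schurEval x n μ * schurEval y m ν),
      Finset.prod_range_succ, coeff_mul, hresc]
    refine Finset.sum_congr rfl fun p _ => ?_
    rw [← ih, Finset.sum_mul, coeff_rescale]
    refine Finset.sum_congr rfl fun ν _ => ?_
    rw [← Finset.sum_mul, ← Finset.sum_mul, sum_stripsAbove_schurEval]
    ring

end Cauchy

section Polynomials

open MvPolynomial SemistandardYoungTableau

theorem prod_pow_ssytWeight {R : Type*} [CommMonoid R] {μ : YoungDiagram}
    {T : SemistandardYoungTableau μ} {n : ℕ} (hT : T ∈ entriesLT n μ) (x : ℕ → R) :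
    ∏ i : Fin n, x i ^ ssytWeight T i = ∏ c ∈ μ.cells, x (T c.1 c.2) := by
  have hmaps : ∀ c ∈ μ.cells, T c.1 c.2 ∈ Finset.range n := fun c hc =>
    Finset.mem_range.2 (mem_entriesLT.1 hT c hc)
  rw [Fin.prod_univ_eq_prod_range (fun i => x i ^ ssytWeight T i) n,
    ← Finset.prod_fiberwise_of_maps_to' hmaps]
  exact Finset.prod_congr rfl fun i _ => (Finset.prod_const _).symm

theorem rename_schurPoly {σ : Type*} {n : ℕ} (e : Fin n → σ) (x : ℕ → MvPolynomial σ ℤ)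
    (hx : ∀ i : Fin n, x i = X (e i)) (μ : YoungDiagram) :
    rename e (schurPoly n μ) = schurEval x n μ := by
  rw [schurPoly, schurEval, finsum_cond_eq_sum_of_cond_iff _ (t := entriesLT n μ)
    fun _ => by simp, map_sum]
  refine Finset.sum_congr rfl fun T hT => ?_
  rw [← prod_pow_ssytWeight hT, map_prod]
  simp only [map_pow, rename_X, hx]

theorem coeff_prod_mk_pow {ι κ R : Type*} [Fintype ι] [Fintype κ] [CommRing R]
    (f : ι → κ → R) (d : ℕ) :
    PowerSeries.coeff d (∏ j, ∏ i, PowerSeries.mk fun k => f i j ^ k) =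
      ∑ᶠ (A : Matrix ι κ ℕ) (_ : ∑ i, ∑ j, A i j = d), ∏ i, ∏ j, f i j ^ A i j := by
  classical
  let e : (ι × κ →₀ ℕ) ≃ Matrix ι κ ℕ := Finsupp.equivFunOnFinite.trans (Equiv.curry ι κ ℕ)
  have he : ∀ l i j, e l i j = l (i, j) := fun _ _ _ => rfl
  rw [Finset.prod_comm,
    ← Fintype.prod_prod_type' (f := fun i j => PowerSeries.mk fun k => f i j ^ k),
    PowerSeries.coeff_prod, finsum_cond_eq_sum_of_cond_iff _
      (t := (Finset.finsuppAntidiag Finset.univ d).map e.toEmbedding), Finset.sum_map]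
  · refine Finset.sum_congr rfl fun l _ => ?_
    simp only [PowerSeries.coeff_mk, Equiv.coe_toEmbedding, he]
    rw [Fintype.prod_prod_type]
  · intro A _
    rw [Finset.mem_map_equiv, Finset.mem_finsuppAntidiag]
    simp only [Finset.subset_univ, and_true]
    obtain ⟨l, rfl⟩ := e.surjective A
    simp only [he, Equiv.symm_apply_apply]
    rw [← Fintype.sum_prod_type']

end Polynomials

open MvPolynomial in
/-- **Cauchy identity / (GL_n, GL_m)-duality on characters.**
`∑_{λ ⊢ d} s_λ(x) s_λ(y)` equals the complete homogeneous polynomial of degree `d` in the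
`n·m` variables `x_i y_j`, i.e. the sum over `n × m` matrices `A` of nonnegative integers with
total sum `d` of `∏_{i,j} (x_i y_j)^{A i j}`. -/
theorem gl_gl_duality_characters (m n d : ℕ) (hm : 0 < m) (hn : 0 < n) :
    ∑ᶠ (lam : YoungDiagram) (_ : lam.card = d),
        (rename Sum.inl (schurPoly n lam) : MvPolynomial (Fin n ⊕ Fin m) ℤ) *
          rename Sum.inr (schurPoly m lam) =
      ∑ᶠ (A : Matrix (Fin n) (Fin m) ℕ) (_ : ∑ i, ∑ j, A i j = d),
        ∏ i : Fin n, ∏ j : Fin m,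
          ((X (Sum.inl i) : MvPolynomial (Fin n ⊕ Fin m) ℤ) * X (Sum.inr j)) ^ A i j := by
  obtain ⟨x, hx⟩ : ∃ x : ℕ → MvPolynomial (Fin n ⊕ Fin m) ℤ,
      ∀ i : Fin n, x i = X (Sum.inl i) :=
    ⟨fun k => if h : k < n then X (Sum.inl ⟨k, h⟩) else 0, fun i => dif_pos i.2⟩
  obtain ⟨y, hy⟩ : ∃ y : ℕ → MvPolynomial (Fin n ⊕ Fin m) ℤ,
      ∀ j : Fin m, y j = X (Sum.inr j) :=
    ⟨fun k => if h : k < m then X (Sum.inr ⟨k, h⟩) else 0, fun j => dif_pos j.2⟩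
  simp only [rename_schurPoly Sum.inl x hx, rename_schurPoly Sum.inr y hy]
  rw [finsum_cond_eq_sum_of_cond_iff _ (t := YoungDiagram.ofCard d)
      fun _ => YoungDiagram.mem_ofCard.symm,
    sum_schurEval_mul_schurEval, ← coeff_prod_mk_pow, Finset.prod_range]
  simp only [Finset.prod_range, hx, hy]
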